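/- arXiv:1605.02728 — 2 statements merged into one kernel-verified Lean document; each statement's English description precedes it below -/
import Mathlib

section
/- For 0 < q < 1, the first Rogers–Ramanujan identity holds: ∑_{n=0}^∞ q^{n²}/(q;q)_n = 1/((q;q⁵)_∞ (q⁴;q⁵)_∞). -/
noncomputable def qp (q a : ℝ) (n : ℕ) : ℝ := ∏ k ∈ Finset.range n, (1 - a * q ^ k)

noncomputable def qpi (q a : ℝ) : ℝ := ∏' k : ℕ, (1 - a * q ^ k)

noncomputable def rr (Q : ℝ) (m : ℤ) : ℝ := if m < 0 then 0 else (qp Q Q m.toNat)⁻¹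

theorem qp_pos {Q : ℝ} (h0 : 0 < Q) (h1 : Q < 1) (n : ℕ) : 0 < qp Q Q n := by
  unfold qp
  apply Finset.prod_pos
  intro k _
  have : Q * Q ^ k < 1 := by
    rw [← pow_succ']
    exact pow_lt_one₀ h0.le h1 (by omega)
  linarith

theorem qp_succ (Q a : ℝ) (n : ℕ) : qp Q a (n + 1) = qp Q a n * (1 - a * Q ^ n) := by
  unfold qp
  rw [Finset.prod_range_succ]

theorem rr_neg (Q : ℝ) {m : ℤ} (h : m < 0) : rr Q m = 0 := by simp [rr, h]

theorem rr_nat (Q : ℝ) (n : ℕ) : rr Q (n : ℤ) = (qp Q Q n)⁻¹ := by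
  simp [rr]

theorem rr_zero (Q : ℝ) : rr Q 0 = 1 := by
  simp [rr, qp]

theorem rr_rec {Q : ℝ} (h0 : 0 < Q) (h1 : Q < 1) (m : ℤ) :
    rr Q (m - 1) = (1 - Q ^ m) * rr Q m := by
  rcases lt_trichotomy m 0 with h | h | h
  · rw [rr_neg Q h, rr_neg Q (by omega)]; simp
  · subst h; simp [rr]
  · obtain ⟨k, rfl⟩ : ∃ k : ℕ, m = (k : ℤ) + 1 := ⟨(m - 1).toNat, by omega⟩
    have e : ((k : ℤ) + 1) = ((k + 1 : ℕ) : ℤ) := by push_cast; rfl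
    rw [add_sub_cancel_right, e, rr_nat, rr_nat, zpow_natCast, qp_succ]
    have := qp_pos h0 h1 (k + 1)
    rw [qp_succ] at this
    have hk := qp_pos h0 h1 k
    have h3 : 1 - Q * Q ^ k ≠ 0 := fun h => by rw [h] at this; simp at this
    have h4 : 1 - Q ^ (k + 1) = 1 - Q * Q ^ k := by ring
    rw [h4]
    field_simp

theorem chu {Q : ℝ} (h0 : 0 < Q) (h1 : Q < 1) (m : ℕ) : ∀ c : ℤ,
    ∑ k ∈ Finset.range (m + 1),
      Q ^ ((k : ℤ) * (k + c)) * rr Q ((m : ℤ) - k) * rr Q k * rr Q (k + c)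
      = rr Q m * rr Q (m + c) := by
  induction m with
  | zero => intro c; simp [rr_zero]
  | succ m ih =>
    intro c
    have hne : (1 - Q ^ ((m : ℤ) + 1)) ≠ 0 := by
      have : Q ^ (m + 1) < 1 := pow_lt_one₀ h0.le h1 (by omega)
      have e : Q ^ ((m : ℤ) + 1) = Q ^ (m + 1) := by
        rw [← zpow_natCast]; push_cast; rfl
      rw [e]; linarith
    apply mul_left_cancel₀ hne
    have key : ∀ k : ℕ, (1 - Q ^ ((m : ℤ) + 1)) *
        (Q ^ ((k : ℤ) * (k + c)) * rr Q ((m : ℤ) + 1 - k) * rr Q k * rr Q (k + c))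
        = Q ^ ((k : ℤ) * (k + c)) * rr Q ((m : ℤ) - k) * rr Q k * rr Q (k + c)
         + Q ^ ((m : ℤ) + 1 - k) * Q ^ ((k : ℤ) * (k + c)) * rr Q ((m : ℤ) + 1 - k)
            * rr Q ((k : ℤ) - 1) * rr Q (k + c) := by
      intro k
      have e1 := rr_rec h0 h1 ((m : ℤ) + 1 - k)
      have e2 := rr_rec h0 h1 (k : ℤ)
      have e3 : (m : ℤ) + 1 - k - 1 = m - k := by ring
      have e4 : Q ^ ((m : ℤ) + 1) = Q ^ ((m : ℤ) + 1 - k) * Q ^ (k : ℤ) := by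
        rw [← zpow_add₀ h0.ne']; congr 1; ring
      rw [e3] at e1
      rw [e1, e2, e4]
      ring
    push_cast
    rw [Finset.mul_sum, Finset.sum_congr rfl (fun k _ => key k), Finset.sum_add_distrib,
      Finset.sum_range_succ, ih c, Finset.sum_range_succ']
    have e5 : ((m : ℤ) - ((m + 1 : ℕ) : ℤ)) < 0 := by push_cast; omega
    rw [rr_neg Q e5]
    have e6 : rr Q (((0 : ℕ) : ℤ) - 1) = 0 := rr_neg Q (by simp)
    rw [e6]
    have shift : ∀ k : ℕ, Q ^ ((m : ℤ) + 1 - ((k + 1 : ℕ) : ℤ)) *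
        Q ^ (((k + 1 : ℕ) : ℤ) * (((k + 1 : ℕ) : ℤ) + c)) * rr Q ((m : ℤ) + 1 - ((k + 1 : ℕ) : ℤ))
            * rr Q (((k + 1 : ℕ) : ℤ) - 1) * rr Q (((k + 1 : ℕ) : ℤ) + c)
        = Q ^ ((m : ℤ) + 1 + c) *
          (Q ^ ((k : ℤ) * (k + (c + 1))) * rr Q ((m : ℤ) - k) * rr Q k * rr Q (k + (c + 1))) := by
      intro k
      rw [← zpow_add₀ h0.ne']
      have a1 : (m : ℤ) + 1 - ((k + 1 : ℕ) : ℤ) + ((k + 1 : ℕ) : ℤ) * (((k + 1 : ℕ) : ℤ) + c)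
        = ((m : ℤ) + 1 + c) + (k : ℤ) * (k + (c + 1)) := by push_cast; ring
      have a2 : (m : ℤ) + 1 - ((k + 1 : ℕ) : ℤ) = m - k := by push_cast; ring
      have a3 : ((k + 1 : ℕ) : ℤ) - 1 = k := by push_cast; ring
      have a4 : ((k + 1 : ℕ) : ℤ) + c = k + (c + 1) := by push_cast; ring
      rw [a1, a2, a3, a4, zpow_add₀ h0.ne']
      ring
    rw [Finset.sum_congr rfl (fun k _ => shift k), ← Finset.mul_sum, ih (c + 1)]
    have b1 := rr_rec h0 h1 ((m : ℤ) + 1)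
    have b2 := rr_rec h0 h1 ((m : ℤ) + 1 + c)
    have b3 : (m : ℤ) + 1 + c - 1 = m + c := by ring
    have b4 : (m : ℤ) + (c + 1) = m + 1 + c := by ring
    rw [add_sub_cancel_right] at b1
    rw [b3] at b2
    rw [b4, b2, b1]
    ring

theorem chu_nat {Q : ℝ} (h0 : 0 < Q) (h1 : Q < 1) (n j : ℕ) :
    ∑ s ∈ Finset.range (n + 1),
      Q ^ ((s : ℤ) ^ 2 - (j : ℤ) ^ 2) * rr Q ((n : ℤ) - s) * (rr Q ((s : ℤ) - j) * rr Q (s + j))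
      = rr Q ((n : ℤ) - j) * rr Q (n + j) := by
  rcases lt_or_ge n j with h | h
  · rw [rr_neg Q (show (n : ℤ) - j < 0 by omega), zero_mul]
    apply Finset.sum_eq_zero
    intro s hs
    rw [Finset.mem_range] at hs
    rw [rr_neg Q (show (s : ℤ) - j < 0 by omega)]
    ring
  · obtain ⟨m, rfl⟩ := Nat.exists_eq_add_of_le h
    rw [add_assoc, Finset.sum_range_add, Finset.sum_eq_zero, zero_add]
    · have := chu h0 h1 m (2 * j)
      have a1 : ((j + m : ℕ) : ℤ) - j = m := by push_cast; ring
      have a2 : ((j + m : ℕ) : ℤ) + j = m + 2 * j := by push_cast; ring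
      rw [a1, a2, ← this]
      apply Finset.sum_congr rfl
      intro k _
      have b1 : ((j + k : ℕ) : ℤ) ^ 2 - (j : ℤ) ^ 2 = (k : ℤ) * (k + 2 * j) := by push_cast; ring
      have b2 : ((j + m : ℕ) : ℤ) - ((j + k : ℕ) : ℤ) = m - k := by push_cast; ring
      have b3 : ((j + k : ℕ) : ℤ) - j = k := by push_cast; ring
      have b4 : ((j + k : ℕ) : ℤ) + j = k + 2 * j := by push_cast; ring
      rw [b1, b2, b3, b4]
      ring
    · intro s hs
      rw [Finset.mem_range] at hs
      rw [rr_neg Q (show (s : ℤ) - j < 0 by omega)]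
      ring

theorem chu_int {Q : ℝ} (h0 : 0 < Q) (h1 : Q < 1) (n : ℕ) (j : ℤ) :
    ∑ s ∈ Finset.range (n + 1),
      Q ^ ((s : ℤ) ^ 2 - j ^ 2) * rr Q ((n : ℤ) - s) * (rr Q ((s : ℤ) - j) * rr Q (s + j))
      = rr Q ((n : ℤ) - j) * rr Q (n + j) := by
  obtain ⟨k, rfl | rfl⟩ := j.eq_nat_or_neg
  · exact chu_nat h0 h1 n k
  · have := chu_nat h0 h1 n k
    rw [sub_neg_eq_add, ← sub_eq_add_neg, mul_comm (rr Q ((n : ℤ) + k)), ← this]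
    apply Finset.sum_congr rfl
    intro s _
    rw [sub_neg_eq_add, ← sub_eq_add_neg, neg_sq]
    ring

/-- The bilateral finite sum. -/
noncomputable def AA (e : ℤ → ℝ) (Q : ℝ) (n : ℕ) : ℝ :=
  ∑' j : ℤ, e j * (rr Q ((n : ℤ) - j) * rr Q (n + j))

theorem AA_summable (e : ℤ → ℝ) (Q : ℝ) (a b : ℤ) :
    Summable fun j : ℤ => e j * (rr Q (a - j) * rr Q (b + j)) := by
  apply summable_of_hasFiniteSupport
  apply (Set.finite_Icc (-b) a).subset
  intro j hj
  by_contra hc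
  apply hj
  rw [Set.mem_Icc, not_and_or, not_le, not_le] at hc
  rcases hc with hc | hc
  · simp [rr_neg Q (show b + j < 0 by omega)]
  · simp [rr_neg Q (show a - j < 0 by omega)]

theorem AA_zero (e : ℤ → ℝ) (Q : ℝ) : AA e Q 0 = e 0 := by
  unfold AA
  rw [tsum_eq_single 0]
  · simp [rr_zero]
  · intro j hj
    rcases lt_or_gt_of_ne hj with h | h
    · rw [rr_neg Q (show ((0 : ℕ) : ℤ) + j < 0 by simpa using h)]; ring
    · rw [rr_neg Q (show ((0 : ℕ) : ℤ) - j < 0 by simpa using h)]; ring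

/-- Bailey-type step. -/
theorem bailey {Q : ℝ} (h0 : 0 < Q) (h1 : Q < 1) (e e' : ℤ → ℝ)
    (he : ∀ j, e j = e' j * Q ^ (j ^ 2)) (n : ℕ) :
    AA e Q n = ∑ s ∈ Finset.range (n + 1), Q ^ (s ^ 2) * rr Q ((n : ℤ) - s) * AA e' Q s := by
  unfold AA
  simp_rw [← tsum_mul_left]
  rw [← Summable.tsum_finsetSum]
  · apply tsum_congr
    intro j
    rw [← chu_int h0 h1 n j, he, Finset.mul_sum]
    apply Finset.sum_congr rfl
    intro s _
    have : Q ^ ((s : ℤ) ^ 2 - j ^ 2) = Q ^ (s ^ 2) / Q ^ (j ^ 2) := by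
      rw [zpow_sub₀ h0.ne']
      congr 1
    rw [this]
    have hz : Q ^ (j ^ 2) ≠ 0 := zpow_ne_zero _ h0.ne'
    field_simp
  · intro s _
    exact (AA_summable e' Q s s).mul_left _

theorem jtp_step {P u : ℝ} (h0 : 0 < P) (h1 : P < 1) (hu : u ≠ 0) (e : ℤ → ℝ)
    (he : ∀ j, e j = (-1) ^ j * u ^ j * P ^ (j ^ 2)) (n : ℕ) :
    AA e (P ^ 2) (n + 1) * ((1 - (P ^ 2) ^ (2 * n + 1)) * (1 - (P ^ 2) ^ (2 * n + 2)))
      = (1 - u * P ^ (2 * n + 1)) * (1 - u⁻¹ * P ^ (2 * n + 1)) * AA e (P ^ 2) n := by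
  set Q := P ^ 2 with hQ
  have hQ0 : 0 < Q := by positivity
  have hQ1 : Q < 1 := pow_lt_one₀ h0.le h1 (by norm_num)
  have s0 := AA_summable e Q n n
  have s1 := (Equiv.addRight (1 : ℤ)).summable_iff.mpr s0
  have s2 := (Equiv.addRight (-1 : ℤ)).summable_iff.mpr s0
  have t1 := (Equiv.addRight (1 : ℤ)).tsum_eq
    (fun j : ℤ => e j * (rr Q ((n : ℤ) - j) * rr Q (n + j)))
  have t2 := (Equiv.addRight (-1 : ℤ)).tsum_eq
    (fun j : ℤ => e j * (rr Q ((n : ℤ) - j) * rr Q (n + j)))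
  have expand : (1 - u * P ^ (2 * n + 1)) * (1 - u⁻¹ * P ^ (2 * n + 1)) * AA e Q n
     = (1 + Q ^ (2 * n + 1)) * AA e Q n - u * P ^ (2 * n + 1) * AA e Q n
        - u⁻¹ * P ^ (2 * n + 1) * AA e Q n := by
    rw [hQ]; field_simp; ring
  rw [expand]
  have f1 : AA e Q n = ∑' j : ℤ, e (j + 1) * (rr Q ((n : ℤ) - (j + 1)) * rr Q (n + (j + 1))) :=
    t1.symm
  have f2 : AA e Q n = ∑' j : ℤ, e (j + -1) * (rr Q ((n : ℤ) - (j + -1)) * rr Q (n + (j + -1))) :=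
    t2.symm
  have g : (1 + Q ^ (2 * n + 1)) * AA e Q n - u * P ^ (2 * n + 1) * AA e Q n
        - u⁻¹ * P ^ (2 * n + 1) * AA e Q n
      = ∑' j : ℤ, ((1 + Q ^ (2 * n + 1)) * (e j * (rr Q ((n : ℤ) - j) * rr Q (n + j)))
        - u * P ^ (2 * n + 1) *
          (e (j + -1) * (rr Q ((n : ℤ) - (j + -1)) * rr Q (n + (j + -1))))
        - u⁻¹ * P ^ (2 * n + 1) *
          (e (j + 1) * (rr Q ((n : ℤ) - (j + 1)) * rr Q (n + (j + 1))))) := by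
    have q0 := s0.mul_left (1 + Q ^ (2 * n + 1))
    have q2 : Summable fun j : ℤ => u * P ^ (2 * n + 1) *
          (e (j + -1) * (rr Q ((n : ℤ) - (j + -1)) * rr Q (n + (j + -1)))) :=
      s2.mul_left (u * P ^ (2 * n + 1))
    have q1 : Summable fun j : ℤ => u⁻¹ * P ^ (2 * n + 1) *
          (e (j + 1) * (rr Q ((n : ℤ) - (j + 1)) * rr Q (n + (j + 1)))) :=
      s1.mul_left (u⁻¹ * P ^ (2 * n + 1))
    rw [(q0.sub q2).tsum_sub q1, q0.tsum_sub q2, tsum_mul_left, tsum_mul_left, tsum_mul_left,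
      ← f1, ← f2]
    rfl
  rw [g]
  unfold AA
  rw [← tsum_mul_right]
  apply tsum_congr
  intro j
  have hP := h0.ne'
  have e1 : e (j + 1) = e j * (-(u * P * (P ^ j) ^ 2)) := by
    rw [he, he, zpow_add₀ (by norm_num), zpow_add₀ hu,
      show (j + 1) ^ 2 = j ^ 2 + j + j + 1 by ring, zpow_add₀ hP, zpow_add₀ hP, zpow_add₀ hP]
    simp; ring
  have e2 : e (j + -1) = e j * (-(u⁻¹ * P / (P ^ j) ^ 2)) := by
    have hz : P ^ j ≠ 0 := zpow_ne_zero _ hP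
    rw [he, he, zpow_add₀ (by norm_num), zpow_add₀ hu,
      show (j + -1) ^ 2 = j ^ 2 - j - j + 1 by ring, zpow_add₀ hP, zpow_sub₀ hP, zpow_sub₀ hP]
    simp; field_simp
  have r1 := rr_rec hQ0 hQ1 ((n : ℤ) + 1 - j)
  have r2 := rr_rec hQ0 hQ1 ((n : ℤ) + 1 + j)
  have r3 := rr_rec hQ0 hQ1 ((n : ℤ) - j)
  have r4 := rr_rec hQ0 hQ1 ((n : ℤ) + j)
  rw [show (n : ℤ) + 1 - j - 1 = n - j by ring] at r1
  rw [show (n : ℤ) + 1 + j - 1 = n + j by ring] at r2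
  rw [e1, e2, show (n : ℤ) - (j + 1) = n - j - 1 by ring,
    show (n : ℤ) + (j + 1) = n + 1 + j by ring,
    show (n : ℤ) - (j + -1) = n + 1 - j by ring, show (n : ℤ) + (j + -1) = n + j - 1 by ring,
    r3, r4, r1, r2]
  push_cast
  have hz : P ^ j ≠ 0 := zpow_ne_zero _ hP
  have z0 : Q ^ j = (P ^ j) ^ 2 := by
    rw [hQ, ← zpow_natCast, ← zpow_natCast, zpow_comm]
  have z1 : Q ^ ((n : ℤ) + 1 - j) = Q ^ (n + 1) / (P ^ j) ^ 2 := by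
    rw [zpow_sub₀ hQ0.ne', z0]; norm_cast
  have z2 : Q ^ ((n : ℤ) + 1 + j) = Q ^ (n + 1) * (P ^ j) ^ 2 := by
    rw [zpow_add₀ hQ0.ne', z0]; norm_cast
  have z3 : Q ^ ((n : ℤ) - j) = Q ^ n / (P ^ j) ^ 2 := by
    rw [zpow_sub₀ hQ0.ne', z0]; norm_cast
  have z4 : Q ^ ((n : ℤ) + j) = Q ^ n * (P ^ j) ^ 2 := by
    rw [zpow_add₀ hQ0.ne', z0]; norm_cast
  rw [z1, z2, z3, z4]
  generalize P ^ j = x at *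
  generalize rr Q ((n : ℤ) + 1 - j) = R1
  generalize rr Q ((n : ℤ) + 1 + j) = R2
  rw [hQ]
  field_simp
  ring

open Filter Topology in
theorem qp_tendsto {Q : ℝ} (h0 : 0 < Q) (h1 : Q < 1) (a : ℝ) :
    Tendsto (qp Q a) atTop (𝓝 (qpi Q a)) := by
  have hs : Summable fun k : ℕ => ‖-(a * Q ^ k)‖ := by
    simp_rw [norm_neg, norm_mul, norm_pow]
    apply Summable.mul_left
    apply summable_geometric_of_lt_one (norm_nonneg _)
    rwa [Real.norm_of_nonneg h0.le]
  have hm := multipliable_one_add_of_summable hs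
  simp_rw [← sub_eq_add_neg] at hm
  exact hm.tendsto_prod_tprod_nat

theorem qpi_ne_zero {Q a : ℝ} (h0 : 0 < Q) (h1 : Q < 1) (ha0 : 0 < a) (ha1 : a < 1) :
    qpi Q a ≠ 0 := by
  have hs : Summable fun k : ℕ => ‖-(a * Q ^ k)‖ := by
    simp_rw [norm_neg, norm_mul, norm_pow]
    apply Summable.mul_left
    apply summable_geometric_of_lt_one (norm_nonneg _)
    rwa [Real.norm_of_nonneg h0.le]
  have := tprod_one_add_ne_zero_of_summable (f := fun k : ℕ => -(a * Q ^ k)) ?_ hs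
  · simp_rw [← sub_eq_add_neg] at this
    exact this
  · intro k
    have h2 : Q ^ k ≤ 1 := pow_le_one₀ h0.le h1.le
    have : a * Q ^ k < 1 := by nlinarith
    intro h
    linarith

open Filter Topology in
theorem rr_tendsto {Q : ℝ} (h0 : 0 < Q) (h1 : Q < 1) :
    Tendsto (rr Q) atTop (𝓝 (qpi Q Q)⁻¹) := by
  have h := (qp_tendsto h0 h1 Q).inv₀ (qpi_ne_zero h0 h1 h0 h1)
  have ht : Tendsto Int.toNat atTop atTop := by
    apply tendsto_atTop.mpr
    intro b
    filter_upwards [eventually_ge_atTop (b : ℤ)] with x hx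
    omega
  apply (h.comp ht).congr'
  filter_upwards [eventually_ge_atTop (0 : ℤ)] with x hx
  simp [rr, not_lt.mpr hx]

theorem rr_bound {Q : ℝ} (h0 : 0 < Q) (h1 : Q < 1) : ∃ C : ℝ, 0 ≤ C ∧ ∀ m, ‖rr Q m‖ ≤ C := by
  have h := (qp_tendsto h0 h1 Q).inv₀ (qpi_ne_zero h0 h1 h0 h1)
  obtain ⟨C, hC⟩ := h.bddAbove_range
  have hC' : ∀ n : ℕ, (qp Q Q n)⁻¹ ≤ C := fun n => hC ⟨n, rfl⟩
  have hC0 : 0 ≤ C := le_trans (inv_nonneg.mpr (qp_pos h0 h1 0).le) (hC' 0)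
  refine ⟨C, hC0, fun m => ?_⟩
  unfold rr
  split_ifs
  · simpa using hC0
  · rw [Real.norm_of_nonneg (inv_nonneg.mpr (qp_pos h0 h1 _).le)]
    exact hC' _

open Filter Topology in
theorem AA_tendsto {Q : ℝ} (h0 : 0 < Q) (h1 : Q < 1) (e : ℤ → ℝ) (he : Summable fun j => ‖e j‖) :
    Tendsto (AA e Q) atTop (𝓝 ((∑' j, e j) * ((qpi Q Q)⁻¹ * (qpi Q Q)⁻¹))) := by
  obtain ⟨C, hC0, hC⟩ := rr_bound h0 h1
  rw [← tsum_mul_right]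
  apply tendsto_tsum_of_dominated_convergence (bound := fun j => ‖e j‖ * (C * C))
  · exact he.mul_right _
  · intro j
    apply Tendsto.const_mul
    have hn : Tendsto (fun n : ℕ => (n : ℤ)) atTop atTop := tendsto_natCast_atTop_atTop
    apply Tendsto.mul
    · exact (rr_tendsto h0 h1).comp (tendsto_atTop_add_const_right _ (-j) hn)
    · exact (rr_tendsto h0 h1).comp (tendsto_atTop_add_const_right _ j hn)
  · refine Eventually.of_forall fun n j => ?_
    rw [norm_mul, norm_mul]
    exact mul_le_mul_of_nonneg_left
      (mul_le_mul (hC _) (hC _) (norm_nonneg _) hC0) (norm_nonneg _)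

noncomputable def ee (p : ℝ) (a : ℕ) (j : ℤ) : ℝ := (-1) ^ j * p ^ j * (p ^ a) ^ (j ^ 2)

theorem ee_summable {p : ℝ} (h0 : 0 < p) (h1 : p < 1) : Summable fun j => ‖ee p 5 j‖ := by
  have key : ∀ j : ℤ, ‖ee p 5 j‖ = p ^ (j + 5 * j ^ 2) := by
    intro j
    unfold ee
    rw [norm_mul, norm_mul, norm_zpow, norm_zpow, norm_zpow, norm_pow, norm_neg, norm_one, one_zpow,
      one_mul, Real.norm_of_nonneg h0.le, zpow_add₀ h0.ne', zpow_mul]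
    norm_cast
  have hb : ∀ (j : ℤ) (n : ℕ), (n : ℤ) ≤ j + 5 * j ^ 2 → ‖ee p 5 j‖ ≤ p ^ n := by
    intro j n h
    rw [key, ← zpow_natCast]
    exact zpow_le_zpow_right_of_le_one₀ h0 h1.le h
  have hg := summable_geometric_of_lt_one h0.le h1
  apply Summable.of_nat_of_neg
  · exact hg.of_nonneg_of_le (fun _ => norm_nonneg _) (fun n => hb _ n (by nlinarith))
  · refine hg.of_nonneg_of_le (fun _ => norm_nonneg _) (fun n => hb _ n ?_)
    have : (n : ℤ) ≤ (n : ℤ) ^ 2 := by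
      have := Nat.le_self_pow (n := 2) (by norm_num) n
      exact_mod_cast this
    nlinarith

theorem ee_step {p : ℝ} (h0 : 0 < p) (a : ℕ) (j : ℤ) :
    ee p (a + 2) j = ee p a j * (p ^ 2) ^ (j ^ 2) := by
  unfold ee
  rw [pow_add, mul_zpow]
  ring

theorem W1 {p : ℝ} (h0 : 0 < p) (h1 : p < 1) (n : ℕ) : AA (ee p 1) (p ^ 2) (n + 1) = 0 := by
  have st := jtp_step h0 h1 h0.ne' (ee p 1) (fun j => by simp [ee])
  have hne : ∀ k : ℕ, 1 - (p ^ 2) ^ (k + 1) ≠ 0 := by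
    intro k
    have : (p ^ 2) ^ (k + 1) < 1 := by
      rw [← pow_mul]
      exact pow_lt_one₀ h0.le h1 (by omega)
    intro h
    linarith
  have hz : ∀ n, AA (ee p 1) (p ^ 2) n *
      ((1 - p * p ^ (2 * n + 1)) * (1 - p⁻¹ * p ^ (2 * n + 1))) = 0 →
      AA (ee p 1) (p ^ 2) (n + 1) = 0 := by
    intro n h
    have := st n
    rw [mul_comm ((1 - p * p ^ (2 * n + 1)) * (1 - p⁻¹ * p ^ (2 * n + 1))), h] at this
    exact (mul_eq_zero.mp this).resolve_right (mul_ne_zero (hne _) (hne _))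
  induction n with
  | zero => apply hz; simp [h0.ne']
  | succ n ih => apply hz; rw [ih, zero_mul]

theorem W3 {p : ℝ} (h0 : 0 < p) (h1 : p < 1) (n : ℕ) :
    AA (ee p 3) (p ^ 2) n = rr (p ^ 2) n := by
  rw [bailey (by positivity) (pow_lt_one₀ h0.le h1 (by norm_num)) _ _ (ee_step h0 1),
    Finset.sum_range_succ', Finset.sum_eq_zero]
  · rw [AA_zero]; simp [ee]
  · intro s _
    rw [W1 h0 h1, mul_zero]

theorem W5 {p : ℝ} (h0 : 0 < p) (h1 : p < 1) (n : ℕ) :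
    AA (ee p 5) (p ^ 2) n =
      ∑' s : ℕ, (p ^ 2) ^ (s ^ 2) * rr (p ^ 2) s * rr (p ^ 2) ((n : ℤ) - s) := by
  rw [bailey (by positivity) (pow_lt_one₀ h0.le h1 (by norm_num)) _ _ (ee_step h0 3),
    tsum_eq_sum (s := Finset.range (n + 1))]
  · apply Finset.sum_congr rfl
    intro s _
    rw [W3 h0 h1]
    ring
  · intro s hs
    rw [Finset.mem_range] at hs
    rw [rr_neg _ (show (n : ℤ) - s < 0 by omega), mul_zero]

open Filter Topology in
theorem W5_tendsto {p : ℝ} (h0 : 0 < p) (h1 : p < 1) :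
    Tendsto (AA (ee p 5) (p ^ 2)) atTop
      (𝓝 ((∑' s : ℕ, (p ^ 2) ^ (s ^ 2) * rr (p ^ 2) s) * (qpi (p ^ 2) (p ^ 2))⁻¹)) := by
  have hq0 : 0 < p ^ 2 := by positivity
  have hq1 : p ^ 2 < 1 := pow_lt_one₀ h0.le h1 (by norm_num)
  rw [show AA (ee p 5) (p ^ 2) = _ from funext (W5 h0 h1), ← tsum_mul_right]
  generalize p ^ 2 = q at *
  obtain ⟨C, hC0, hC⟩ := rr_bound hq0 hq1
  apply tendsto_tsum_of_dominated_convergence (bound := fun s : ℕ => q ^ s * (C * C))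
  · exact (summable_geometric_of_lt_one hq0.le hq1).mul_right _
  · intro j
    apply Tendsto.const_mul
    have hn : Tendsto (fun n : ℕ => (n : ℤ)) atTop atTop := tendsto_natCast_atTop_atTop
    exact (rr_tendsto hq0 hq1).comp (tendsto_atTop_add_const_right _ (-(j : ℤ)) hn)
  · refine Eventually.of_forall fun n s => ?_
    rw [norm_mul, norm_mul, mul_assoc, Real.norm_of_nonneg (by positivity)]
    apply mul_le_mul _ (mul_le_mul (hC _) (hC _) (norm_nonneg _) hC0) (by positivity)
      (by positivity)
    exact pow_le_pow_of_le_one hq0.le hq1.le (Nat.le_self_pow (by norm_num) s)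

theorem jtp_fin {p : ℝ} (h0 : 0 < p) (h1 : p < 1) (n : ℕ) :
    AA (ee p 5) ((p ^ 5) ^ 2) n * qp ((p ^ 5) ^ 2) ((p ^ 5) ^ 2) (2 * n)
      = qp ((p ^ 5) ^ 2) (p ^ 4) n * qp ((p ^ 5) ^ 2) (p ^ 6) n := by
  induction n with
  | zero => rw [AA_zero]; simp [ee, qp]
  | succ n ih =>
    have st := jtp_step (P := p ^ 5) (by positivity) (pow_lt_one₀ h0.le h1 (by norm_num))
      h0.ne' (ee p 5) (fun j => by simp [ee]) n
    rw [show 2 * (n + 1) = 2 * n + 1 + 1 by ring, qp_succ, qp_succ, qp_succ, qp_succ]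
    have a1 : 1 - (p ^ 5) ^ 2 * ((p ^ 5) ^ 2) ^ (2 * n) = 1 - ((p ^ 5) ^ 2) ^ (2 * n + 1) := by
      ring
    have a2 : 1 - (p ^ 5) ^ 2 * ((p ^ 5) ^ 2) ^ (2 * n + 1) = 1 - ((p ^ 5) ^ 2) ^ (2 * n + 2) := by
      ring
    have a3 : 1 - p ^ 6 * ((p ^ 5) ^ 2) ^ n = 1 - p * (p ^ 5) ^ (2 * n + 1) := by
      ring
    have a4 : 1 - p ^ 4 * ((p ^ 5) ^ 2) ^ n = 1 - p⁻¹ * (p ^ 5) ^ (2 * n + 1) := by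
      have : p⁻¹ * (p ^ 5) ^ (2 * n + 1) = p⁻¹ * p * (p ^ 4 * ((p ^ 5) ^ 2) ^ n) := by ring
      rw [this, inv_mul_cancel₀ h0.ne', one_mul]
    rw [a1, a2, a3, a4]
    calc _ = (AA (ee p 5) ((p ^ 5) ^ 2) (n + 1) *
        ((1 - ((p ^ 5) ^ 2) ^ (2 * n + 1)) * (1 - ((p ^ 5) ^ 2) ^ (2 * n + 2)))) *
          qp ((p ^ 5) ^ 2) ((p ^ 5) ^ 2) (2 * n) := by ring
      _ = (1 - p * (p ^ 5) ^ (2 * n + 1)) * (1 - p⁻¹ * (p ^ 5) ^ (2 * n + 1)) *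
          (AA (ee p 5) ((p ^ 5) ^ 2) n * qp ((p ^ 5) ^ 2) ((p ^ 5) ^ 2) (2 * n)) := by
            rw [st]; ring
      _ = _ := by rw [ih]; ring

theorem qp_split (q : ℝ) (n : ℕ) : qp q q (5 * n) =
    qp (q ^ 5) q n * qp (q ^ 5) (q ^ 2) n * qp (q ^ 5) (q ^ 3) n * qp (q ^ 5) (q ^ 4) n
      * qp (q ^ 5) (q ^ 5) n := by
  induction n with
  | zero => simp [qp]
  | succ n ih =>
    rw [show 5 * (n + 1) = 5 * n + 1 + 1 + 1 + 1 + 1 by ring]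
    simp only [qp_succ]
    rw [ih]
    ring

open Filter Topology in
theorem qpi_split {q : ℝ} (h0 : 0 < q) (h1 : q < 1) : qpi q q =
    qpi (q ^ 5) q * qpi (q ^ 5) (q ^ 2) * qpi (q ^ 5) (q ^ 3) * qpi (q ^ 5) (q ^ 4)
      * qpi (q ^ 5) (q ^ 5) := by
  have hQ0 : 0 < q ^ 5 := by positivity
  have hQ1 : q ^ 5 < 1 := pow_lt_one₀ h0.le h1 (by norm_num)
  have t5 : Tendsto (fun n : ℕ => 5 * n) atTop atTop :=
    tendsto_id.const_mul_atTop' (by norm_num)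
  have l := (qp_tendsto h0 h1 q).comp t5
  have r := ((((qp_tendsto hQ0 hQ1 q).mul (qp_tendsto hQ0 hQ1 (q ^ 2))).mul
    (qp_tendsto hQ0 hQ1 (q ^ 3))).mul (qp_tendsto hQ0 hQ1 (q ^ 4))).mul
    (qp_tendsto hQ0 hQ1 (q ^ 5))
  refine tendsto_nhds_unique l (r.congr fun n => ?_)
  exact (qp_split q n).symm

open Filter Topology in
theorem rr_core {p : ℝ} (h0 : 0 < p) (h1 : p < 1) :
    ∑' s : ℕ, (p ^ 2) ^ (s ^ 2) * rr (p ^ 2) s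
      = 1 / (qpi ((p ^ 2) ^ 5) (p ^ 2) * qpi ((p ^ 2) ^ 5) ((p ^ 2) ^ 4)) := by
  have hq0 : 0 < p ^ 2 := by positivity
  have hq1 : p ^ 2 < 1 := pow_lt_one₀ h0.le h1 (by norm_num)
  have hQ0 : 0 < (p ^ 5) ^ 2 := by positivity
  have hQ1 : (p ^ 5) ^ 2 < 1 := by
    rw [← pow_mul]; exact pow_lt_one₀ h0.le h1 (by norm_num)
  have es := ee_summable h0 h1
  have u1 := tendsto_nhds_unique (W5_tendsto h0 h1) (AA_tendsto hq0 hq1 _ es)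
  have t2 : Tendsto (fun n : ℕ => 2 * n) atTop atTop :=
    tendsto_id.const_mul_atTop' (by norm_num)
  have l := (AA_tendsto hQ0 hQ1 _ es).mul ((qp_tendsto hQ0 hQ1 ((p ^ 5) ^ 2)).comp t2)
  have r := (qp_tendsto hQ0 hQ1 (p ^ 4)).mul (qp_tendsto hQ0 hQ1 (p ^ 6))
  have u2 := tendsto_nhds_unique l (r.congr fun n => (jtp_fin h0 h1 n).symm)
  have sp := qpi_split hq0 hq1
  rw [show (p ^ 5) ^ 2 = (p ^ 2) ^ 5 by ring] at u2 hQ0 hQ1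
  rw [show p ^ 4 = (p ^ 2) ^ 2 by ring, show p ^ 6 = (p ^ 2) ^ 3 by ring] at u2
  generalize (∑' j, ee p 5 j) = Θ at *
  generalize p ^ 2 = q at *
  have n0 := qpi_ne_zero hq0 hq1 hq0 hq1
  have hk : ∀ k : ℕ, k ≠ 0 → qpi (q ^ 5) (q ^ k) ≠ 0 := fun k hk =>
    qpi_ne_zero hQ0 hQ1 (by positivity) (pow_lt_one₀ hq0.le hq1 hk)
  have n1 := hk 1 (by norm_num)
  have n2 := hk 2 (by norm_num)
  have n3 := hk 3 (by norm_num)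
  have n4 := hk 4 (by norm_num)
  have n5 := hk 5 (by norm_num)
  rw [pow_one] at n1
  have hΘ : Θ = qpi (q ^ 5) (q ^ 2) * qpi (q ^ 5) (q ^ 3) * qpi (q ^ 5) (q ^ 5) := by
    rw [← u2]; field_simp
  have hS : (∑' s : ℕ, q ^ (s ^ 2) * rr q s) = Θ * (qpi q q)⁻¹ := by
    apply mul_right_cancel₀ (inv_ne_zero n0)
    rw [u1, mul_assoc]
  rw [hS, hΘ, sp]
  field_simp

theorem rogers_ramanujan_first (q : ℝ) (hq0 : 0 < q) (hq1 : q < 1) :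
    ∑' n : ℕ, q ^ (n ^ 2) / qp q q n = 1 / (qpi (q ^ 5) q * qpi (q ^ 5) (q ^ 4)) := by
  have h := rr_core (p := Real.sqrt q) (Real.sqrt_pos.mpr hq0)
    (by rw [Real.sqrt_lt' one_pos]; simpa using hq1)
  rw [Real.sq_sqrt hq0.le] at h
  rw [← h]
  apply tsum_congr
  intro n
  rw [rr_nat, div_eq_mul_inv]
end

section
/- For 0 < q < 1, the second Rogers–Ramanujan identity holds: ∑_{n=0}^∞ q^{n²+n}/(q;q)_n = 1/((q²;q⁵)_∞ (q³;q⁵)_∞). -/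
open Filter Topology

/-- `1/(q;q)_n` extended by zero to negative integers. -/
noncomputable def rru (q : ℝ) (n : ℤ) : ℝ := if n < 0 then 0 else 1 / qp q q n.toNat

/-- theta coefficients `(-z)^j q^(j(j-1)/2)`. -/
noncomputable def rrc (q z : ℝ) (j : ℤ) : ℝ := (-z) ^ j * q ^ (j * (j - 1) / 2)

lemma rr_qp_pos (q : ℝ) (hq0 : 0 < q) (hq1 : q < 1) (n : ℕ) : 0 < qp q q n := by
  unfold qp
  apply Finset.prod_pos
  intro k _
  have : q * q ^ k < 1 := by
    rw [← pow_succ']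
    exact pow_lt_one₀ hq0.le hq1 (by omega)
  linarith

lemma rru_neg (q : ℝ) {n : ℤ} (h : n < 0) : rru q n = 0 := by simp [rru, h]

lemma rru_nat (q : ℝ) (n : ℕ) : rru q n = 1 / qp q q n := by simp [rru]

lemma rru_zero (q : ℝ) : rru q 0 = 1 := by simp [rru, qp]

lemma rru_rec (q : ℝ) (hq0 : 0 < q) (hq1 : q < 1) (n : ℤ) :
    (1 - q ^ n) * rru q n = rru q (n - 1) := by
  rcases lt_trichotomy n 0 with h | h | h
  · rw [rru_neg q h, rru_neg q (by omega)]; simp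
  · subst h; rw [rru_neg q (n := 0 - 1) (by omega)]; simp
  · obtain ⟨m, rfl⟩ : ∃ m : ℕ, n = (m : ℤ) + 1 := ⟨(n - 1).toNat, by omega⟩
    have e : (m : ℤ) + 1 = ((m + 1 : ℕ) : ℤ) := by push_cast; rfl
    rw [add_sub_cancel_right, e, rru_nat, rru_nat, zpow_natCast]
    have h1 := rr_qp_pos q hq0 hq1 (m + 1)
    have h2 := rr_qp_pos q hq0 hq1 m
    have h3 : qp q q (m + 1) = qp q q m * (1 - q ^ (m + 1)) := by
      unfold qp; rw [Finset.prod_range_succ, pow_succ' q m]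
    have h4 : 1 - q ^ (m + 1) ≠ 0 := by
      intro h; rw [h, mul_zero] at h3; exact h1.ne' h3
    rw [h3]
    field_simp

lemma rrc_zero (q z : ℝ) : rrc q z 0 = 1 := by simp [rrc]

lemma rrc_succ (q z : ℝ) (hq0 : 0 < q) (hz : z ≠ 0) (j : ℤ) :
    rrc q z (j + 1) = -z * q ^ j * rrc q z j := by
  unfold rrc
  have h : (j + 1) * (j + 1 - 1) / 2 = j + j * (j - 1) / 2 := by
    have : (j + 1) * (j + 1 - 1) = j * (j - 1) + j * 2 := by ring
    rw [this, Int.add_mul_ediv_right _ _ (by norm_num)]; ring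
  rw [h, zpow_add₀ hq0.ne', zpow_add₀ (neg_ne_zero.mpr hz), zpow_one]; ring

lemma rr_summ (f : ℤ → ℝ) (a b : ℤ) (h : ∀ j, j < a ∨ b < j → f j = 0) : Summable f := by
  apply summable_of_ne_finset_zero (s := Finset.Icc a b)
  intro j hj
  apply h
  simp at hj
  by_cases h1 : a ≤ j
  · right; exact hj h1
  · left; omega

lemma rr_shift (f : ℤ → ℝ) (k : ℤ) : ∑' j, f (j + k) = ∑' j, f j :=
  (Equiv.addRight k).tsum_eq f

lemma rr_summ_shift (f : ℤ → ℝ) (k : ℤ) (h : Summable f) : Summable (fun j => f (j + k)) :=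
  (Equiv.addRight k).summable_iff.mpr h

/-- `∑ c_j u(A-j) u(B+j)` -/
noncomputable def rrS (q z : ℝ) (A B : ℤ) : ℝ := ∑' j : ℤ, rrc q z j * rru q (A - j) * rru q (B + j)

lemma rrS_recB (q z : ℝ) (hq0 : 0 < q) (hq1 : q < 1) (hz : z ≠ 0) (A B : ℤ) :
    (1 - q ^ (A + B)) * rrS q z A B = (1 - q ^ B / z) * rrS q z A (B - 1) := by
  unfold rrS
  have s1 : Summable (fun j : ℤ => rrc q z j * rru q (A - j) * rru q (B - 1 + j)) := by
    apply rr_summ _ (1 - B) A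
    rintro j (h | h)
    · rw [rru_neg q (n := B - 1 + j) (by omega)]; simp
    · rw [rru_neg q (n := A - j) (by omega)]; simp
  have key : ∀ j : ℤ, (1 - q ^ (A + B)) * (rrc q z j * rru q (A - j) * rru q (B + j)) =
      rrc q z j * rru q (A - j) * rru q (B - 1 + j) +
      (-(q ^ B / z)) * (rrc q z (j + 1) * rru q (A - (j + 1)) * rru q (B - 1 + (j + 1))) := by
    intro j
    have h1 := rru_rec q hq0 hq1 (A - j)
    have h2 := rru_rec q hq0 hq1 (B + j)
    rw [show A - (j + 1) = A - j - 1 by ring, show B - 1 + (j + 1) = B + j by ring,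
      show B - 1 + j = B + j - 1 by ring, ← h1, ← h2, rrc_succ q z hq0 hz,
      show A + B = (A - j) + (B + j) by ring, zpow_add₀ hq0.ne' (A - j), zpow_add₀ hq0.ne' B]
    field_simp
    ring
  rw [← tsum_mul_left]
  simp_rw [key]
  rw [Summable.tsum_add s1, tsum_mul_left,
    rr_shift (fun j => rrc q z j * rru q (A - j) * rru q (B - 1 + j)) 1]
  · ring
  · have s2 := rr_summ_shift _ 1 s1
    exact s2.mul_left _

lemma rrS_recA (q z : ℝ) (hq0 : 0 < q) (hq1 : q < 1) (hz : z ≠ 0) (A B : ℤ) :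
    (1 - q ^ (A + B)) * rrS q z A B = (1 - z * q ^ (A - 1)) * rrS q z (A - 1) B := by
  unfold rrS
  have s1 : Summable (fun j : ℤ => rrc q z j * rru q (A - 1 - j) * rru q (B + j)) := by
    apply rr_summ _ (- B) A
    rintro j (h | h)
    · rw [rru_neg q (n := B + j) (by omega)]; simp
    · rw [rru_neg q (n := A - 1 - j) (by omega)]; simp
  have key : ∀ j : ℤ, (1 - q ^ (A + B)) * (rrc q z j * rru q (A - j) * rru q (B + j)) =
      rrc q z j * rru q (A - 1 - j) * rru q (B + j) +
      (-(z * q ^ (A - 1))) *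
        (rrc q z (j + -1) * rru q (A - 1 - (j + -1)) * rru q (B + (j + -1))) := by
    intro j
    have h1 := rru_rec q hq0 hq1 (A - j)
    have h2 := rru_rec q hq0 hq1 (B + j)
    have h3 := rrc_succ q z hq0 hz (j + -1)
    rw [show j + -1 + 1 = j by ring] at h3
    rw [show A - 1 - (j + -1) = A - j by ring, show B + (j + -1) = B + j - 1 by ring,
      show A - 1 - j = A - j - 1 by ring, ← h1, ← h2, h3,
      show A + B = (A - j) + (B + j) by ring, zpow_add₀ hq0.ne' (A - j),
      show A - 1 = (A - j) + (j + -1) by ring, zpow_add₀ hq0.ne' (A - j)]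
    ring
  rw [← tsum_mul_left]
  simp_rw [key]
  rw [Summable.tsum_add s1, tsum_mul_left,
    rr_shift (fun j => rrc q z j * rru q (A - 1 - j) * rru q (B + j)) (-1)]
  · ring
  · have s2 := rr_summ_shift _ (-1) s1
    exact s2.mul_left _

lemma rrS_zero (q z : ℝ) : rrS q z 0 0 = 1 := by
  unfold rrS
  rw [tsum_eq_single 0]
  · simp [rrc_zero, rru_zero]
  · intro j hj
    rcases lt_or_gt_of_ne hj with h | h
    · rw [rru_neg q (n := 0 + j) (by omega)]; simp
    · rw [rru_neg q (n := 0 - j) (by omega)]; simp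

lemma rr_one_sub_pos (q : ℝ) (hq0 : 0 < q) (hq1 : q < 1) (n : ℤ) (h : 0 < n) : 0 < 1 - q ^ n := by
  obtain ⟨m, rfl⟩ : ∃ m : ℕ, n = m := ⟨n.toNat, by omega⟩
  rw [zpow_natCast]
  have := pow_lt_one₀ hq0.le hq1 (n := m) (by omega)
  linarith

/-- finite Jacobi triple product -/
lemma rrS_prod (q z : ℝ) (hq0 : 0 < q) (hq1 : q < 1) (hz : z ≠ 0) (N : ℕ) :
    rrS q z N N = qp q z N * qp q (q / z) N * rru q (2 * N) := by
  induction N with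
  | zero => simp [rrS_zero, qp, rru_zero]
  | succ N ih =>
    have hA := rrS_recA q z hq0 hq1 hz (N + 1) (N + 1)
    have hB := rrS_recB q z hq0 hq1 hz N (N + 1)
    have u1 := rru_rec q hq0 hq1 (2 * N + 1)
    have u2 := rru_rec q hq0 hq1 (2 * N + 2)
    have p1 := rr_one_sub_pos q hq0 hq1 (2 * N + 1) (by omega)
    have p2 := rr_one_sub_pos q hq0 hq1 (2 * N + 2) (by omega)
    simp only [add_sub_cancel_right] at hA hB u1
    rw [show (2 * (N : ℤ) + 2 - 1) = 2 * N + 1 by ring] at u2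
    rw [show (N : ℤ) + 1 + (N + 1) = 2 * N + 2 by ring] at hA
    rw [show (N : ℤ) + (N + 1) = 2 * N + 1 by ring] at hB
    have e1 : qp q z (N + 1) = qp q z N * (1 - z * q ^ N) := by
      unfold qp; rw [Finset.prod_range_succ]
    have e2 : qp q (q / z) (N + 1) = qp q (q / z) N * (1 - q / z * q ^ N) := by
      unfold qp; rw [Finset.prod_range_succ]
    push_cast
    rw [e1, e2, show (2 * ((N : ℤ) + 1)) = 2 * N + 2 by ring]
    apply mul_left_cancel₀ p1.ne'
    apply mul_left_cancel₀ p2.ne'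
    have hqn : q ^ ((N : ℤ) + 1) / z = q / z * q ^ N := by
      rw [zpow_add₀ hq0.ne', zpow_natCast, zpow_one]; ring
    rw [hqn, ih] at hB
    rw [zpow_natCast] at hA
    calc _ = (1 - q ^ (2 * (N : ℤ) + 1)) *
          ((1 - q ^ (2 * (N : ℤ) + 2)) * rrS q z (N + 1) (N + 1)) := by ring
      _ = (1 - z * q ^ N) * ((1 - q ^ (2 * (N : ℤ) + 1)) * rrS q z N (N + 1)) := by rw [hA]; ring
      _ = (1 - z * q ^ N) * ((1 - q / z * q ^ N) * (qp q z N * qp q (q / z) N * rru q (2 * N))) := by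
          rw [hB]
      _ = _ := by rw [← u1, ← u2]; ring

/-- `∑ c_j u(N-j) u(N+1+j) = δ_{N,0}` for `z = 1` -/
lemma rrS_delta (q : ℝ) (hq0 : 0 < q) (hq1 : q < 1) (N : ℤ) :
    rrS q 1 N (N + 1) = if N = 0 then 1 else 0 := by
  have key : ∀ N : ℤ, 0 ≤ N → (1 - q ^ (2 * N + 1)) * rrS q 1 N (N + 1) =
      (1 - q ^ (N + 1)) * rrS q 1 N N := by
    intro N _
    have := rrS_recB q 1 hq0 hq1 one_ne_zero N (N + 1)
    simpa [show N + (N + 1) = 2 * N + 1 by ring] using this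
  split_ifs with h
  · subst h
    have h1 := key 0 le_rfl
    have p1 := rr_one_sub_pos q hq0 hq1 1 (by omega)
    rw [rrS_zero] at h1
    simp only [mul_zero, zero_add, mul_one] at h1 ⊢
    exact mul_left_cancel₀ p1.ne' (by rw [h1, mul_one])
  · rcases lt_or_gt_of_ne h with h | h
    · unfold rrS
      rw [show (0 : ℝ) = ∑' _ : ℤ, (0 : ℝ) by simp]
      congr 1; funext j
      by_cases hj : N - j < 0
      · rw [rru_neg q hj]; simp
      · rw [rru_neg q (n := N + 1 + j) (by omega)]; simp
    · obtain ⟨m, rfl⟩ : ∃ m : ℕ, N = (m + 1 : ℕ) := ⟨(N - 1).toNat, by omega⟩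
      have h1 := key _ h.le
      have p1 := rr_one_sub_pos q hq0 hq1 (2 * (m + 1 : ℕ) + 1) (by omega)
      rw [rrS_prod q 1 hq0 hq1 one_ne_zero] at h1
      have : qp q 1 (m + 1) = 0 := by
        unfold qp; rw [Finset.prod_range_succ']; simp
      rw [this] at h1
      simp only [zero_mul, mul_zero] at h1
      exact (mul_eq_zero.mp h1).resolve_left p1.ne'

/-- q-Vandermonde -/
lemma rr_vand (q : ℝ) (hq0 : 0 < q) (hq1 : q < 1) (M : ℕ) : ∀ m : ℤ,
    ∑' s : ℤ, q ^ (s * (s + m)) * rru q (M - s) * rru q s * rru q (s + m) =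
      rru q M * rru q (M + m) := by
  induction M with
  | zero =>
    intro m
    rw [tsum_eq_single 0]
    · simp [rru_zero]
    · intro j hj
      rcases lt_or_gt_of_ne hj with h | h
      · rw [rru_neg q h]; simp
      · rw [rru_neg q (n := ((0 : ℕ) : ℤ) - j) (by push_cast; omega)]; simp
  | succ M ih =>
    intro m
    have p1 := rr_one_sub_pos q hq0 hq1 (M + 1) (by omega)
    have u1 := rru_rec q hq0 hq1 (M + 1)
    rw [add_sub_cancel_right] at u1
    apply mul_left_cancel₀ p1.ne'
    push_cast
    rw [← mul_assoc, u1, show (M : ℤ) + 1 + m = M + (m + 1) by ring, ← ih (m + 1), ← tsum_mul_left]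
    set F : ℤ → ℝ := fun s => q ^ (s * (s + m)) * rru q (M + 1 - s) * rru q (s - 1) * rru q (s + m)
      with hF
    set G : ℤ → ℝ := fun s => q ^ (s * (s + m + 1)) * rru q (M - s) * rru q s * rru q (s + m)
      with hG
    have sF : Summable F := by
      apply rr_summ _ 1 (M + 1)
      rintro j (h | h) <;> simp only [hF]
      · rw [rru_neg q (n := j - 1) (by omega)]; simp
      · rw [rru_neg q (n := M + 1 - j) (by omega)]; simp
    have sG : Summable G := by
      apply rr_summ _ 0 M
      rintro j (h | h) <;> simp only [hG]
      · rw [rru_neg q (n := j) (by omega)]; simp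
      · rw [rru_neg q (n := M - j) (by omega)]; simp
    have sF1 : Summable (fun s => F (s + 1)) := rr_summ_shift _ 1 sF
    have k1 : ∀ s : ℤ, (1 - q ^ ((M : ℤ) + 1)) *
        (q ^ (s * (s + m)) * rru q (M + 1 - s) * rru q s * rru q (s + m)) = F s + G s := by
      intro s
      simp only [hF, hG]
      rw [← rru_rec q hq0 hq1 s, show (M : ℤ) - s = M + 1 - s - 1 by ring,
        ← rru_rec q hq0 hq1 (M + 1 - s), show s * (s + m + 1) = s * (s + m) + s by ring,
        zpow_add₀ hq0.ne' _ s]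
      have : q ^ ((M : ℤ) + 1) = q ^ ((M : ℤ) + 1 - s) * q ^ s := by
        rw [← zpow_add₀ hq0.ne']; congr 1; ring
      rw [this]; ring
    have k2 : ∀ s : ℤ, F (s + 1) + G s =
        q ^ (s * (s + (m + 1))) * rru q (M - s) * rru q s * rru q (s + (m + 1)) := by
      intro s
      simp only [hF, hG]
      have := rru_rec q hq0 hq1 (s + (m + 1))
      rw [show s + (m + 1) - 1 = s + m by ring] at this
      rw [← this, show (M : ℤ) + 1 - (s + 1) = M - s by ring, add_sub_cancel_right,
        show s + 1 + m = s + (m + 1) by ring, show s + m + 1 = s + (m + 1) by ring,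
        show (s + 1) * (s + (m + 1)) = s * (s + (m + 1)) + (s + (m + 1)) by ring,
        zpow_add₀ hq0.ne' (s * (s + (m + 1)))]
      ring
    simp_rw [k1, ← k2]
    rw [Summable.tsum_add sF sG, Summable.tsum_add sF1 sG, rr_shift F 1]

lemma rr_vand2 (q : ℝ) (hq0 : 0 < q) (hq1 : q < 1) (N j : ℤ) :
    ∑' r : ℤ, q ^ (r ^ 2 + r) * rru q (N - r) * rru q (r - j) * rru q (r + 1 + j) =
      q ^ (j ^ 2 + j) * rru q (N - j) * rru q (N + 1 + j) := by
  by_cases h : N - j < 0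
  · rw [rru_neg q h]
    rw [show q ^ (j ^ 2 + j) * 0 * rru q (N + 1 + j) = ∑' _ : ℤ, (0 : ℝ) by simp]
    congr 1; funext r
    by_cases hr : N - r < 0
    · rw [rru_neg q hr]; simp
    · rw [rru_neg q (n := r - j) (by omega)]; simp
  · obtain ⟨M, hM⟩ : ∃ M : ℕ, N - j = M := ⟨(N - j).toNat, by omega⟩
    have := rr_vand q hq0 hq1 M (2 * j + 1)
    rw [show N + 1 + j = M + (2 * j + 1) by omega, hM, mul_assoc, ← this, ← tsum_mul_left,
      ← rr_shift _ j]
    congr 1; funext s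
    rw [show (s + j) ^ 2 + (s + j) = (j ^ 2 + j) + s * (s + (2 * j + 1)) by ring,
      zpow_add₀ hq0.ne', show N - (s + j) = M - s by omega, add_sub_cancel_right,
      show s + j + 1 + j = s + (2 * j + 1) by ring]
    ring

lemma rr_bailey (q : ℝ) (hq0 : 0 < q) (hq1 : q < 1) (N : ℤ) (α : ℤ → ℝ) :
    ∑' j : ℤ, q ^ (j ^ 2 + j) * α j * rru q (N - j) * rru q (N + 1 + j) =
    ∑' r : ℤ, q ^ (r ^ 2 + r) * rru q (N - r) *
      ∑' j : ℤ, α j * rru q (r - j) * rru q (r + 1 + j) := by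
  have h1 : ∀ j : ℤ, q ^ (j ^ 2 + j) * α j * rru q (N - j) * rru q (N + 1 + j) =
      ∑' r : ℤ, α j *
        (q ^ (r ^ 2 + r) * rru q (N - r) * rru q (r - j) * rru q (r + 1 + j)) := by
    intro j
    rw [tsum_mul_left, rr_vand2 q hq0 hq1]; ring
  simp_rw [h1, ← tsum_mul_left]
  rw [Summable.tsum_comm]
  · congr 1; funext r; congr 1; funext j; ring
  · apply summable_of_ne_finset_zero
      (s := Finset.Icc (-1 - N) N ×ˢ Finset.Icc (-1 - N) N)
    rintro ⟨r, j⟩ hb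
    simp only [Finset.mem_product, Finset.mem_Icc, not_and_or, not_le] at hb
    simp only [Function.uncurry]
    by_cases a1 : N - r < 0
    · rw [rru_neg q a1]; simp
    by_cases a2 : r - j < 0
    · rw [rru_neg q a2]; simp
    by_cases a3 : r + 1 + j < 0
    · rw [rru_neg q a3]; simp
    omega

lemma rr_summ_geom (q a : ℝ) (hq0 : 0 < q) (hq1 : q < 1) : Summable (fun k : ℕ => ‖-(a * q ^ k)‖) := by
  have : Summable (fun k : ℕ => |a| * q ^ k) :=
    (summable_geometric_of_lt_one hq0.le hq1).mul_left _
  refine this.congr ?_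
  intro k
  rw [norm_neg, norm_mul, Real.norm_eq_abs, Real.norm_eq_abs, abs_of_pos (pow_pos hq0 k)]

lemma rr_qp_tendsto (q a : ℝ) (hq0 : 0 < q) (hq1 : q < 1) :
    Tendsto (fun N : ℕ => qp q a N) atTop (𝓝 (qpi q a)) := by
  have h := multipliable_one_add_of_summable (rr_summ_geom q a hq0 hq1)
  have := h.tendsto_prod_tprod_nat
  simpa only [qp, qpi, sub_eq_add_neg] using this

lemma rr_qpi_ne (q a : ℝ) (hq0 : 0 < q) (hq1 : q < 1) (ha0 : 0 < a) (ha1 : a < 1) :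
    qpi q a ≠ 0 := by
  have := tprod_one_add_ne_zero_of_summable (f := fun k : ℕ => -(a * q ^ k)) ?_
    (rr_summ_geom q a hq0 hq1)
  · simpa only [qpi, sub_eq_add_neg] using this
  · intro k
    have h1 : q ^ k ≤ 1 := pow_le_one₀ hq0.le hq1.le
    have h2 : a * q ^ k < 1 := by nlinarith [pow_pos hq0 k]
    intro h
    linarith

lemma rru_tendsto (q : ℝ) (hq0 : 0 < q) (hq1 : q < 1) :
    Tendsto (fun n : ℤ => rru q n) atTop (𝓝 (1 / qpi q q)) := by
  have h : Tendsto (fun n : ℕ => 1 / qp q q n) atTop (𝓝 (1 / qpi q q)) :=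
    tendsto_const_nhds.div (rr_qp_tendsto q q hq0 hq1) (rr_qpi_ne q q hq0 hq1 hq0 hq1)
  have ht : Tendsto Int.toNat atTop atTop := by
    rw [tendsto_atTop]
    intro b
    filter_upwards [eventually_ge_atTop (b : ℤ)] with n hn
    omega
  refine (h.comp ht).congr' ?_
  filter_upwards [eventually_ge_atTop (0 : ℤ)] with n hn
  simp [rru, not_lt.mpr hn]

lemma rru_nonneg (q : ℝ) (hq0 : 0 < q) (hq1 : q < 1) (n : ℤ) : 0 ≤ rru q n := by
  unfold rru
  split_ifs
  · exact le_rfl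
  · exact (one_div_pos.mpr (rr_qp_pos q hq0 hq1 _)).le

lemma rru_bdd (q : ℝ) (hq0 : 0 < q) (hq1 : q < 1) : ∃ C, 0 ≤ C ∧ ∀ n, rru q n ≤ C := by
  have h : Tendsto (fun n : ℕ => rru q (n : ℤ)) atTop (𝓝 (1 / qpi q q)) :=
    (rru_tendsto q hq0 hq1).comp tendsto_natCast_atTop_atTop
  obtain ⟨C, hC⟩ := h.bddAbove_range
  have hC' : ∀ n : ℕ, rru q n ≤ C := fun n => hC ⟨n, rfl⟩
  have h0 : 0 ≤ C := (rru_nonneg q hq0 hq1 _).trans (hC' 0)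
  refine ⟨C, h0, fun n => ?_⟩
  by_cases hn : n < 0
  · rw [rru_neg q hn]; exact h0
  · have := hC' n.toNat
    rwa [Int.toNat_of_nonneg (by omega)] at this

lemma rr_tannery (q : ℝ) (hq0 : 0 < q) (hq1 : q < 1) (α : ℤ → ℝ) (hα : Summable α) (k : ℤ) :
    Tendsto (fun N : ℕ => ∑' j : ℤ, α j * rru q (N - j) * rru q (N + k + j)) atTop
      (𝓝 ((∑' j, α j) * (1 / qpi q q) * (1 / qpi q q))) := by
  obtain ⟨C, hC0, hC⟩ := rru_bdd q hq0 hq1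
  rw [← tsum_mul_right, ← tsum_mul_right]
  have hu := rru_tendsto q hq0 hq1
  apply tendsto_tsum_of_dominated_convergence (bound := fun j => ‖α j‖ * C * C)
  · exact (hα.norm.mul_right C).mul_right C
  · intro j
    have t1 : Tendsto (fun N : ℕ => (N : ℤ) - j) atTop atTop :=
      tendsto_atTop_add_const_right _ (-j) tendsto_natCast_atTop_atTop
    have t2 : Tendsto (fun N : ℕ => (N : ℤ) + k + j) atTop atTop :=
      tendsto_atTop_add_const_right _ j
        (tendsto_atTop_add_const_right _ k tendsto_natCast_atTop_atTop)
    exact (tendsto_const_nhds.mul (hu.comp t1)).mul (hu.comp t2)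
  · filter_upwards with N j
    rw [norm_mul, norm_mul, Real.norm_of_nonneg (rru_nonneg q hq0 hq1 _),
      Real.norm_of_nonneg (rru_nonneg q hq0 hq1 _)]
    have a1 := rru_nonneg q hq0 hq1 (N + k + j)
    gcongr
    · exact hC _
    · exact hC _

lemma rr_tannery1 (q : ℝ) (hq0 : 0 < q) (hq1 : q < 1) (α : ℤ → ℝ) (hα : Summable α) :
    Tendsto (fun N : ℕ => ∑' j : ℤ, α j * rru q (N - j)) atTop
      (𝓝 ((∑' j, α j) * (1 / qpi q q))) := by
  obtain ⟨C, hC0, hC⟩ := rru_bdd q hq0 hq1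
  rw [← tsum_mul_right]
  have hu := rru_tendsto q hq0 hq1
  apply tendsto_tsum_of_dominated_convergence (bound := fun j => ‖α j‖ * C)
  · exact hα.norm.mul_right C
  · intro j
    have t1 : Tendsto (fun N : ℕ => (N : ℤ) - j) atTop atTop :=
      tendsto_atTop_add_const_right _ (-j) tendsto_natCast_atTop_atTop
    exact tendsto_const_nhds.mul (hu.comp t1)
  · filter_upwards with N j
    rw [norm_mul, Real.norm_of_nonneg (rru_nonneg q hq0 hq1 _)]
    gcongr
    exact hC _

lemma rr_summ_abs (q : ℝ) (hq0 : 0 < q) (hq1 : q < 1) : Summable (fun j : ℤ => q ^ j.natAbs) := by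
  have := summable_geometric_of_lt_one hq0.le hq1
  apply Summable.of_nat_of_neg
  · simpa using this
  · simpa using this

lemma rrc_eq (q : ℝ) (hq0 : 0 < q) (j : ℤ) :
    q ^ (j ^ 2 + j) * (q ^ (j ^ 2 + j) * rrc q 1 j) = rrc (q ^ 5) (q ^ 4) j := by
  unfold rrc
  obtain ⟨t, ht⟩ : ∃ t, j * (j - 1) = 2 * t := by
    have h := Int.even_mul_pred_self j
    obtain ⟨t, ht⟩ := h
    exact ⟨t, by rw [ht]; ring⟩
  rw [ht, Int.mul_ediv_cancel_left _ (by norm_num), neg_eq_neg_one_mul (q ^ 4), mul_zpow,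
    ← zpow_natCast, ← zpow_natCast, ← zpow_mul, ← zpow_mul]
  have : q ^ (((4 : ℕ) : ℤ) * j) * q ^ (((5 : ℕ) : ℤ) * t) =
      q ^ (j ^ 2 + j) * q ^ (j ^ 2 + j) * q ^ t := by
    rw [← zpow_add₀ hq0.ne', ← zpow_add₀ hq0.ne', ← zpow_add₀ hq0.ne']
    congr 1
    push_cast
    linear_combination (-2) * ht
  rw [mul_assoc ((-1) ^ j), this]; ring

lemma rrc_summ (q : ℝ) (hq0 : 0 < q) (hq1 : q < 1) : Summable (rrc (q ^ 5) (q ^ 4)) := by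
  apply Summable.of_norm_bounded (rr_summ_abs q hq0 hq1)
  intro j
  unfold rrc
  obtain ⟨t, ht⟩ : ∃ t, j * (j - 1) = 2 * t := by
    have h := Int.even_mul_pred_self j
    obtain ⟨t, ht⟩ := h
    exact ⟨t, by rw [ht]; ring⟩
  rw [ht, Int.mul_ediv_cancel_left _ (by norm_num), norm_mul, norm_zpow, norm_neg, norm_zpow,
    Real.norm_of_nonneg (by positivity), Real.norm_of_nonneg (by positivity),
    ← zpow_natCast, ← zpow_natCast, ← zpow_mul, ← zpow_mul, ← zpow_add₀ hq0.ne', ← zpow_natCast]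
  apply zpow_le_zpow_right_of_le_one₀ hq0 hq1.le
  push_cast
  rcases abs_cases j with ⟨h1, h2⟩ | ⟨h1, h2⟩ <;> rw [h1] <;> nlinarith

/-- theta sum via triple product -/
lemma rr_theta (q : ℝ) (hq0 : 0 < q) (hq1 : q < 1) :
    ∑' j, rrc (q ^ 5) (q ^ 4) j = qpi (q ^ 5) (q ^ 4) * qpi (q ^ 5) q * qpi (q ^ 5) (q ^ 5) := by
  have hQ0 : 0 < q ^ 5 := by positivity
  have hQ1 : q ^ 5 < 1 := pow_lt_one₀ hq0.le hq1 (by norm_num)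
  have hne := rr_qpi_ne _ _ hQ0 hQ1 hQ0 hQ1
  have t1 := rr_tannery (q ^ 5) hQ0 hQ1 _ (rrc_summ q hq0 hq1) 0
  have t2 : Tendsto (fun N : ℕ => ((2 : ℤ) * N)) atTop atTop :=
    Tendsto.const_mul_atTop' (by norm_num) tendsto_natCast_atTop_atTop
  have t3 := ((rr_qp_tendsto (q ^ 5) (q ^ 4) hQ0 hQ1).mul (rr_qp_tendsto (q ^ 5) q hQ0 hQ1)).mul
    ((rru_tendsto (q ^ 5) hQ0 hQ1).comp t2)
  have e : ∀ N : ℕ, ∑' j : ℤ, rrc (q ^ 5) (q ^ 4) j * rru (q ^ 5) (N - j) * rru (q ^ 5) (N + 0 + j) =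
      qp (q ^ 5) (q ^ 4) N * qp (q ^ 5) q N * rru (q ^ 5) (2 * N) := by
    intro N
    have := rrS_prod (q ^ 5) (q ^ 4) hQ0 hQ1 (by positivity) N
    rw [show q ^ 5 / q ^ 4 = q by field_simp] at this
    rw [← this]
    simp only [rrS, add_zero]
  have := tendsto_nhds_unique (t1.congr e) t3
  field_simp at this
  rw [this]; ring

lemma rr_main (q : ℝ) (hq0 : 0 < q) (hq1 : q < 1) :
    ∑' r : ℤ, q ^ (r ^ 2 + r) * rru q r = (∑' j, rrc (q ^ 5) (q ^ 4) j) / qpi q q := by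
  have hne := rr_qpi_ne _ _ hq0 hq1 hq0 hq1
  have s1 : ∀ N : ℤ, ∑' j : ℤ, (q ^ (j ^ 2 + j) * rrc q 1 j) * rru q (N - j) * rru q (N + 1 + j) =
      rru q N := by
    intro N
    rw [rr_bailey q hq0 hq1, tsum_eq_single 0]
    · have := rrS_delta q hq0 hq1 0
      unfold rrS at this
      rw [this]; simp
    · intro r hr
      have := rrS_delta q hq0 hq1 r
      unfold rrS at this
      rw [this]; simp [hr]
  have s2 : ∀ N : ℕ, ∑' j : ℤ, rrc (q ^ 5) (q ^ 4) j * rru q (N - j) * rru q (N + 1 + j) =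
      ∑' r : ℤ, (q ^ (r ^ 2 + r) * rru q r) * rru q (N - r) := by
    intro N
    have := rr_bailey q hq0 hq1 N (fun j => q ^ (j ^ 2 + j) * rrc q 1 j)
    simp_rw [s1, rrc_eq q hq0] at this
    rw [this]
    congr 1; funext r; ring
  have hs : Summable (fun r : ℤ => q ^ (r ^ 2 + r) * rru q r) := by
    obtain ⟨C, hC0, hC⟩ := rru_bdd q hq0 hq1
    apply Summable.of_norm_bounded ((rr_summ_abs q hq0 hq1).mul_right C)
    intro r
    by_cases hr : r < 0
    · rw [rru_neg q hr]; simp; positivity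
    · rw [norm_mul, Real.norm_of_nonneg (rru_nonneg q hq0 hq1 _),
        Real.norm_of_nonneg (by positivity)]
      apply mul_le_mul _ (hC r) (rru_nonneg q hq0 hq1 _) (by positivity)
      rw [← zpow_natCast]
      apply zpow_le_zpow_right_of_le_one₀ hq0 hq1.le
      push_cast
      rw [abs_of_nonneg (by omega)]
      nlinarith
  have := tendsto_nhds_unique ((rr_tannery q hq0 hq1 _ (rrc_summ q hq0 hq1) 1).congr s2)
    (rr_tannery1 q hq0 hq1 _ hs)
  field_simp at this
  field_simp
  rw [this]; ring

lemma rr_split (q : ℝ) (hq0 : 0 < q) (hq1 : q < 1) :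
    qpi q q = qpi (q ^ 5) q * qpi (q ^ 5) (q ^ 2) * qpi (q ^ 5) (q ^ 3) * qpi (q ^ 5) (q ^ 4) *
      qpi (q ^ 5) (q ^ 5) := by
  have hQ0 : 0 < q ^ 5 := by positivity
  have hQ1 : q ^ 5 < 1 := pow_lt_one₀ hq0.le hq1 (by norm_num)
  have h := fun a => rr_qp_tendsto (q ^ 5) a hQ0 hQ1
  have t5 : Tendsto (fun N : ℕ => 5 * N) atTop atTop :=
    Tendsto.const_mul_atTop' (by norm_num) tendsto_id
  have h1 := (rr_qp_tendsto q q hq0 hq1).comp t5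
  refine tendsto_nhds_unique h1
    ((((((h q).mul (h (q ^ 2))).mul (h (q ^ 3))).mul (h (q ^ 4))).mul (h (q ^ 5))).congr ?_)
  intro N
  simp only [Function.comp]
  induction N with
  | zero => simp [qp]
  | succ N ih =>
    rw [show 5 * (N + 1) = 5 * N + 1 + 1 + 1 + 1 + 1 by ring]
    simp only [qp, Finset.prod_range_succ] at ih ⊢
    rw [← ih]
    ring

theorem rogers_ramanujan_second (q : ℝ) (hq0 : 0 < q) (hq1 : q < 1) :
    ∑' n : ℕ, q ^ (n ^ 2 + n) / qp q q n = 1 / (qpi (q ^ 5) (q ^ 2) * qpi (q ^ 5) (q ^ 3)) := by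
  have hQ0 : 0 < q ^ 5 := by positivity
  have hQ1 : q ^ 5 < 1 := pow_lt_one₀ hq0.le hq1 (by norm_num)
  have h := fun a => rr_qpi_ne (q ^ 5) a hQ0 hQ1
  have h1 := h q hq0 hq1
  have h2 := h (q ^ 2) (by positivity) (pow_lt_one₀ hq0.le hq1 (by norm_num))
  have h3 := h (q ^ 3) (by positivity) (pow_lt_one₀ hq0.le hq1 (by norm_num))
  have h4 := h (q ^ 4) (by positivity) (pow_lt_one₀ hq0.le hq1 (by norm_num))
  have h5 := h (q ^ 5) (by positivity) (pow_lt_one₀ hq0.le hq1 (by norm_num))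
  have hm := rr_main q hq0 hq1
  rw [rr_theta q hq0 hq1, rr_split q hq0 hq1] at hm
  have e : ∑' n : ℕ, q ^ (n ^ 2 + n) / qp q q n = ∑' r : ℤ, q ^ (r ^ 2 + r) * rru q r := by
    rw [← Function.Injective.tsum_eq (g := ((↑) : ℕ → ℤ)) Nat.cast_injective]
    · congr 1; funext n
      rw [rru_nat, show (n : ℤ) ^ 2 + n = ((n ^ 2 + n : ℕ) : ℤ) by push_cast; rfl, zpow_natCast]
      ring
    · intro r hr
      simp only [Function.mem_support] at hr
      refine ⟨r.toNat, ?_⟩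
      by_contra hne
      apply hr
      rw [rru_neg q (by omega)]; simp
  rw [e, hm]
  field_simp
end
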